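/- Let G ∈ 𝓑_k(n) with 4 ≤ k ≤ 9 and n ≥ 15. If λ_3(G) ≥ 0 (i.e., G ∉ 𝓑_k^−(n)), then G has an induced subgraph Γ' of order 15 with Γ' ∈ 𝓑_k(15) and λ_3(Γ') ≥ 0 (i.e., Γ' ∈ 𝓑_k(15) ∖ 𝓑_k^−(15)). -/

import Mathlib

open Matrix BigOperators

namespace TwoPosEig

variable {V : Type*}

/-- The real adjacency matrix of a simple graph (classical decidability). -/
noncomputable def adjMat [Fintype V] [DecidableEq V] (G : SimpleGraph V) : Matrix V V ℝ :=
  letI := Classical.decRel G.Adj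
  G.adjMatrix ℝ

lemma adjMat_isHermitian [Fintype V] [DecidableEq V] (G : SimpleGraph V) :
    (adjMat G).IsHermitian := by
  letI := Classical.decRel G.Adj
  rw [Matrix.IsHermitian, Matrix.conjTranspose_eq_transpose_of_trivial]
  exact SimpleGraph.isSymm_adjMatrix G

/-- The eigenvalues of (the adjacency matrix of) a graph, as a function on vertices. -/
noncomputable def eigs [Fintype V] [DecidableEq V] (G : SimpleGraph V) : V → ℝ :=
  (adjMat_isHermitian G).eigenvalues

/-- `p(G)`: the number of positive eigenvalues (with multiplicity). -/
noncomputable def posCount [Finite V] (G : SimpleGraph V) : ℕ :=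
  letI := Fintype.ofFinite V
  letI := Classical.decEq V
  Nat.card {i : V // 0 < eigs G i}

/-- `η(G)`: the number of zero eigenvalues (with multiplicity), the nullity. -/
noncomputable def nullCount [Finite V] (G : SimpleGraph V) : ℕ :=
  letI := Fintype.ofFinite V
  letI := Classical.decEq V
  Nat.card {i : V // eigs G i = 0}

/-- `λ_k(G)`: the `k`-th largest eigenvalue (1-indexed); junk value `0` out of range. -/
noncomputable def lam [Finite V] (G : SimpleGraph V) (k : ℕ) : ℝ :=
  letI := Fintype.ofFinite V
  letI := Classical.decEq V
  (((Finset.univ.val.map (eigs G)).sort (· ≤ ·)).reverse).getD (k - 1) 0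

/-- Membership in `𝒢^s(n)` (the order `n` being the cardinality of the vertex type):
`p(G) = 2` and `η(G) = s`. -/
def memClass [Finite V] (s : ℕ) (G : SimpleGraph V) : Prop :=
  posCount G = 2 ∧ nullCount G = s

/-- `v` is a congruent vertex of I-type: some other vertex `u`, non-adjacent to `v`,
has the same neighbourhood. -/
def ITypeVertex (G : SimpleGraph V) (v : V) : Prop :=
  ∃ u, u ≠ v ∧ ¬ G.Adj u v ∧ G.neighborSet u = G.neighborSet v

/-- `u` is a congruent vertex of II-type: there are two non-adjacent vertices `v, w`
such that `N(u)` is a disjoint union of `N(v)` and `N(w)`. -/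
def IITypeVertex (G : SimpleGraph V) (u : V) : Prop :=
  ∃ v w, v ≠ w ∧ ¬ G.Adj v w ∧ Disjoint (G.neighborSet v) (G.neighborSet w) ∧
    G.neighborSet u = G.neighborSet v ∪ G.neighborSet w

/-- `u v x y` is a congruent (induced) quadrangle with congruent edges `uv`, `xy`. -/
def CongruentQuad (G : SimpleGraph V) (u v x y : V) : Prop :=
  u ≠ v ∧ u ≠ x ∧ u ≠ y ∧ v ≠ x ∧ v ≠ y ∧ x ≠ y ∧
  G.Adj u v ∧ G.Adj v x ∧ G.Adj x y ∧ G.Adj y u ∧ ¬ G.Adj u x ∧ ¬ G.Adj v y ∧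
  G.neighborSet u \ {y, v} = G.neighborSet v \ {u, x} ∧
  G.neighborSet x \ {v, y} = G.neighborSet y \ {x, u}

/-- A congruent vertex of III-type: a vertex of some congruent quadrangle. -/
def IIITypeVertex (G : SimpleGraph V) (z : V) : Prop :=
  ∃ u v x y, CongruentQuad G u v x y ∧ (z = u ∨ z = v ∨ z = x ∨ z = y)

/-- Membership in `𝒢_1^s(n)`: a connected graph obtained by adding a congruent vertex
of I-type to some graph in `𝒢^{s-1}(n-1)`. -/
def memG1 {n : ℕ} (s : ℕ) (G : SimpleGraph (Fin n)) : Prop :=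
  G.Connected ∧ ∃ v : Fin n, ITypeVertex G v ∧ memClass (s - 1) (G.induce {v}ᶜ)

/-- Membership in `𝒢_2^s(n)`. -/
def memG2 {n : ℕ} (s : ℕ) (G : SimpleGraph (Fin n)) : Prop :=
  G.Connected ∧ ∃ v : Fin n, IITypeVertex G v ∧ memClass (s - 1) (G.induce {v}ᶜ)

/-- Membership in `𝒢_3^s(n)`. -/
def memG3 {n : ℕ} (s : ℕ) (G : SimpleGraph (Fin n)) : Prop :=
  G.Connected ∧ ∃ v : Fin n, IIITypeVertex G v ∧ memClass (s - 1) (G.induce {v}ᶜ)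

/-- Oboudi's graph `G_m`: two cliques `K_{⌈m/2⌉}` (on `v_1, …`) and `K_{⌊m/2⌋}`
(on `w_1, …`), where `v_i ∼ w_j` iff `j ≥ ⌊m/2⌋ - i + 2` (1-indexed), i.e. (0-indexed)
`⌊m/2⌋ ≤ i + j`. -/
def oboudi (m : ℕ) : SimpleGraph (Fin ((m + 1) / 2) ⊕ Fin (m / 2)) :=
  SimpleGraph.fromRel fun a b =>
    match a, b with
    | Sum.inl _, Sum.inl _ => True
    | Sum.inr _, Sum.inr _ => True
    | Sum.inl i, Sum.inr j => m / 2 ≤ (i : ℕ) + (j : ℕ)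
    | Sum.inr _, Sum.inl _ => False

/-- The generalized lexicographic product `G[K_{t v}]`: each vertex `v` is replaced by a
clique of order `t v`, with complete joins along edges of `G`. -/
def lexProd (G : SimpleGraph V) (t : V → ℕ) : SimpleGraph (Σ v : V, Fin (t v)) :=
  SimpleGraph.fromRel fun a b => a.1 = b.1 ∨ G.Adj a.1 b.1

/-- Index conversion identifying the vertices `v_1, …, v_{⌈k/2⌉}, w_1, …, w_{⌊k/2⌋}`
of `G_k` with `Fin k` (in this order). -/
def toIdx {k : ℕ} : Fin ((k + 1) / 2) ⊕ Fin (k / 2) → Fin k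
  | Sum.inl i => ⟨(i : ℕ), by have := i.isLt; omega⟩
  | Sum.inr j => ⟨(k + 1) / 2 + (j : ℕ), by have := j.isLt; omega⟩

/-- `B_k(n_1, …, n_k) = G_k[K_{n_1}, …, K_{n_k}]`. -/
def bGraph (k : ℕ) (nn : Fin k → ℕ) :
    SimpleGraph (Σ v : Fin ((k + 1) / 2) ⊕ Fin (k / 2), Fin (nn (toIdx v))) :=
  lexProd (oboudi k) fun v => nn (toIdx v)

/-- Membership in `𝓓* = {B_k(n_1,…,n_k) ∈ 𝓑_k^{00}(n) : 4 ≤ k ≤ 14, n ≤ 14}` (up to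
isomorphism). -/
def memDstar {n : ℕ} (G : SimpleGraph (Fin n)) : Prop :=
  ∃ (k : ℕ) (nn : Fin k → ℕ), 4 ≤ k ∧ k ≤ 14 ∧ (∀ i, 1 ≤ nn i) ∧ (∑ i, nn i) ≤ 14 ∧
    lam (bGraph k nn) 3 = 0 ∧ lam (bGraph k nn) 4 = 0 ∧ Nonempty (G ≃g bGraph k nn)

/-- The degree of a vertex. -/
noncomputable def deg [Finite V] (G : SimpleGraph V) (v : V) : ℕ :=
  Nat.card (G.neighborSet v)

/-- `v` is a vertex of minimum degree. -/
def IsMinDegVertex [Finite V] (G : SimpleGraph V) (v : V) : Prop :=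
  ∀ w, deg G v ≤ deg G w

/-- The set `Y = V(G) ∖ N[v]`. -/
def Yset (G : SimpleGraph V) (v : V) : Set V :=
  (G.neighborSet v ∪ {v})ᶜ

/-- `G` is `X`-complete with respect to `v`: `G[Y] ≅ K_{n-t-1}` with `n-t-1 ≥ 2`
and `G[X]` is complete, where `X = N(v)`, `Y = V(G) ∖ N[v]`. -/
def IsXComplete [Finite V] (G : SimpleGraph V) (v : V) : Prop :=
  2 ≤ (Yset G v).ncard ∧ (Yset G v).Pairwise G.Adj ∧ (G.neighborSet v).Pairwise G.Adj

/-- An `X`-complete graph is reduced when the traces on `Y` of the neighbourhoods of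
vertices of `X` form a chain. -/
def IsReduced (G : SimpleGraph V) (v : V) : Prop :=
  ∀ x ∈ G.neighborSet v, ∀ x' ∈ G.neighborSet v,
    G.neighborSet x ∩ Yset G v ⊆ G.neighborSet x' ∩ Yset G v ∨
    G.neighborSet x' ∩ Yset G v ⊆ G.neighborSet x ∩ Yset G v

/-! ### Chain ordering: the combinatorial determinant -/

/-- closed adjacency in the chain ordering `v_0, w_last, v_1, …` -/
def adjC (t s : ℕ) : Bool :=
  (t % 2 == s % 2) || (t % 2 == 0 && Nat.blt s t) || (s % 2 == 0 && Nat.blt t s)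

def sgnC (R : Type*) [CommRing R] (t : ℕ) : R := if t % 2 = 0 then 1 else -1

def cM (R : Type*) [CommRing R] (t s : ℕ) : R := if adjC t s = true then 1 else 0

lemma cM_symm (R : Type*) [CommRing R] (t s : ℕ) : cM R t s = cM R s t := by
  have : adjC t s = adjC s t := by
    rw [Bool.eq_iff_iff]; simp [adjC]; grind
  simp [cM, this]

lemma cM_step (R : Type*) [CommRing R] (t s : ℕ) :
    cM R (t + 2) s - cM R t s = if s = t + 1 then sgnC R t else 0 := by
  have h1 : adjC (t+2) s = true ↔ (t % 2 = s % 2 ∨ (t % 2 = 0 ∧ s < t + 2) ∨ (s % 2 = 0 ∧ t + 2 < s)) := by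
    simp [adjC, or_assoc]
  have h2 : adjC t s = true ↔ (t % 2 = s % 2 ∨ (t % 2 = 0 ∧ s < t) ∨ (s % 2 = 0 ∧ t < s)) := by
    simp [adjC, or_assoc]
  unfold cM sgnC
  by_cases h : s = t + 1
  · subst h
    by_cases ht : t % 2 = 0
    · have a1 : adjC (t+2) (t+1) = true := h1.2 (by omega)
      have a2 : ¬ adjC t (t+1) = true := fun h => by have := h2.1 h; omega
      simp [a1, a2, ht]
    · have a1 : ¬ adjC (t+2) (t+1) = true := fun h => by have := h1.1 h; omega
      have a2 : adjC t (t+1) = true := h2.2 (by omega)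
      simp [a1, a2, ht]
  · have : (adjC (t+2) s = true) ↔ (adjC t s = true) := by
      rw [h1, h2]; omega
    simp [this, h]

def seqC {R : Type*} [CommRing R] (n : ℕ → R) (a b : R) : ℕ → R × R
  | 0 => (a, b)
  | t + 1 => ((seqC n a b t).2, (seqC n a b t).1 + sgnC R t * (n (t + 1) * (seqC n a b t).2))

lemma seqC_rec {R : Type*} [CommRing R] (n : ℕ → R) (a b : R) (t : ℕ) :
    (seqC n a b (t + 2)).1 = (seqC n a b t).1 + sgnC R t * (n (t + 1) * (seqC n a b (t + 1)).1) := by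
  simp [seqC]

def sumTo {R : Type*} [CommRing R] (f : ℕ → R) : ℕ → R
  | 0 => 0
  | m + 1 => sumTo f m + f m

lemma sumTo_eq {R : Type*} [CommRing R] (f : ℕ → R) (m : ℕ) :
    sumTo f m = ∑ i ∈ Finset.range m, f i := by
  induction m with
  | zero => simp [sumTo]
  | succ m ih => simp [sumTo, ih, Finset.sum_range_succ]

def rowC {R : Type*} [CommRing R] (k : ℕ) (n : ℕ → R) (a b : R) (t : ℕ) : R :=
  (seqC n a b t).1 - sumTo (fun s => cM R t s * (n s * (seqC n a b s).1)) k

lemma rowC_step {R : Type*} [CommRing R] (k : ℕ) (n : ℕ → R) (a b : R) (t : ℕ) (ht : t + 2 < k) :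
    rowC k n a b (t + 2) = rowC k n a b t := by
  unfold rowC
  rw [seqC_rec, sumTo_eq, sumTo_eq]
  have : ∑ i ∈ Finset.range k, cM R (t+2) i * (n i * (seqC n a b i).1)
      - ∑ i ∈ Finset.range k, cM R t i * (n i * (seqC n a b i).1)
      = sgnC R t * (n (t + 1) * (seqC n a b (t + 1)).1) := by
    rw [← Finset.sum_sub_distrib]
    rw [Finset.sum_eq_single (t+1)]
    · rw [← sub_mul, cM_step]; simp
    · intro s _ hs
      rw [← sub_mul, cM_step]; simp [hs]
    · intro h; exfalso; apply h; simp; omega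
  linear_combination (-1) * this

def detF {R : Type*} [CommRing R] (k : ℕ) (n : ℕ → R) : R :=
  rowC k n 1 0 0 * rowC k n 0 1 1 - rowC k n 0 1 0 * rowC k n 1 0 1

def matA {R : Type*} [CommRing R] (k : ℕ) (n : ℕ → R) : Matrix (Fin k) (Fin k) R :=
  Matrix.of fun t s => (if t = s then 1 else 0) - cM R t s * n s

def matU {R : Type*} [CommRing R] (k : ℕ) (n : ℕ → R) : Matrix (Fin k) (Fin k) R :=
  Matrix.of fun t s => if s.val = 0 then (seqC n 1 0 t).1 else
    if s.val = 1 then (seqC n 0 1 t).1 else if t = s then 1 else 0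

def matS (R : Type*) [CommRing R] (k : ℕ) : Matrix (Fin k) (Fin k) R :=
  Matrix.of fun t s => if s.val + 2 = t.val then 1 else 0

lemma det_matU {R : Type*} [CommRing R] (k : ℕ) (n : ℕ → R) : (matU k n).det = 1 := by
  rw [Matrix.det_of_isLowerTriangular]
  · apply Finset.prod_eq_one
    intro i _
    simp only [matU, Matrix.of_apply]
    split_ifs with h1 h2
    · simp [h1, seqC]
    · simp [h2, seqC]
    · rfl
  · intro i j hij
    have hij' : i.val < j.val := by simpa using hij
    simp only [matU, Matrix.of_apply]
    rw [if_neg (by omega)]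
    split_ifs with h1 h2
    · have : i.val = 0 := by omega
      simp [this, seqC]
    · subst h2; omega
    · rfl

lemma det_oneSubS (R : Type*) [CommRing R] (k : ℕ) : (1 - matS R k).det = 1 := by
  rw [Matrix.det_of_isLowerTriangular]
  · apply Finset.prod_eq_one
    intro i _
    simp [matS]
  · intro i j hij
    have hij' : i.val < j.val := by simpa using hij
    have : i ≠ j := by rintro rfl; omega
    simp only [matS, Matrix.sub_apply, Matrix.of_apply, Matrix.one_apply, this, if_false]
    rw [if_neg (by omega)]; simp

lemma matAU {R : Type*} [CommRing R] (k : ℕ) (n : ℕ → R) (t s : Fin k) :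
    (matA k n * matU k n) t s = if s.val = 0 then rowC k n 1 0 t else
      if s.val = 1 then rowC k n 0 1 t else matA k n t s := by
  rw [Matrix.mul_apply]
  have key : ∀ a b : R, ∑ u : Fin k, matA k n t u * (seqC n a b u).1 = rowC k n a b t := by
    intro a b
    unfold rowC
    rw [sumTo_eq, Finset.sum_range (fun s => cM R t s * (n s * (seqC n a b s).1))]
    simp only [matA, Matrix.of_apply, sub_mul, Finset.sum_sub_distrib, ite_mul, one_mul, zero_mul,
      Finset.sum_ite_eq, Finset.mem_univ, if_true, mul_assoc]
  split_ifs with h1 h2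
  · rw [← key]; simp [matU, h1]
  · rw [← key]; simp [matU, h2]
  · simp [matU, h1, h2]

lemma matS_mul {R : Type*} [CommRing R] (k : ℕ) (B : Matrix (Fin k) (Fin k) R) (t s : Fin k) :
    (matS R k * B) t s = if h : 2 ≤ t.val then B ⟨t.val - 2, by omega⟩ s else 0 := by
  rw [Matrix.mul_apply]
  split_ifs with h
  · rw [Finset.sum_eq_single ⟨t.val - 2, by omega⟩]
    · simp only [matS, Matrix.of_apply]; rw [if_pos (by omega)]; simp
    · intro b _ hb
      simp only [matS, Matrix.of_apply]; rw [if_neg]; simp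
      intro h'; apply hb; ext; simp; omega
    · simp
  · apply Finset.sum_eq_zero
    intro b _
    simp only [matS, Matrix.of_apply]; rw [if_neg (by omega)]; simp

theorem det_matA {R : Type*} [CommRing R] (k : ℕ) (hk : 2 ≤ k) (n : ℕ → R) :
    (matA k n).det = detF k n := by
  set C := (1 - matS R k) * (matA k n * matU k n) with hC
  have hdet : (matA k n).det = C.det := by
    rw [hC, Matrix.det_mul, Matrix.det_mul, det_oneSubS, det_matU]; simp
  have hCe : ∀ t s, C t s = (matA k n * matU k n) t s -
      (if h : 2 ≤ t.val then (matA k n * matU k n) ⟨t.val - 2, by omega⟩ s else 0) := by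
    intro t s
    rw [hC, Matrix.sub_mul, Matrix.one_mul, Matrix.sub_apply, matS_mul]
  rw [hdet, Matrix.twoBlockTriangular_det C (fun i => i.val < 2)]
  · have h2 : (Matrix.toSquareBlockProp C (fun i => ¬ i.val < 2)).det = 1 := by
      rw [Matrix.det_of_isLowerTriangular]
      · apply Finset.prod_eq_one
        rintro ⟨i, hi⟩ _
        have hi' : 2 ≤ i.val := by omega
        simp only [Matrix.toSquareBlockProp_def, Matrix.of_apply, hCe, matAU]
        rw [dif_pos hi', if_neg (by omega), if_neg (by omega), if_neg (by omega), if_neg (by omega)]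
        simp only [matA, Matrix.of_apply]
        rw [if_pos trivial, if_neg (by intro h; have := congrArg Fin.val h; simp at this; omega)]
        have := cM_step R (i.val - 2) i.val
        rw [Nat.sub_add_cancel hi', if_neg (by omega)] at this
        linear_combination (- n i.val) * this
      · rintro ⟨i, hi⟩ ⟨j, hj⟩ hij
        have hij' : i.val < j.val := by simpa using hij
        have hi' : 2 ≤ i.val := by omega
        simp only [Matrix.toSquareBlockProp_def, Matrix.of_apply, hCe, matAU]
        rw [dif_pos hi', if_neg (by omega), if_neg (by omega), if_neg (by omega), if_neg (by omega)]
        simp only [matA, Matrix.of_apply]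
        rw [if_neg (by intro h; have := congrArg Fin.val h; omega), if_neg (by intro h; have := congrArg Fin.val h; simp at this; omega)]
        have := cM_step R (i.val - 2) j.val
        rw [Nat.sub_add_cancel hi', if_neg (by omega)] at this
        linear_combination (- n j.val) * this
    rw [h2, mul_one]
    let e : Fin 2 ≃ {i : Fin k // i.val < 2} :=
      { toFun := fun i => ⟨⟨i.val, by omega⟩, i.isLt⟩
        invFun := fun i => ⟨i.1.val, i.2⟩
        left_inv := fun i => rfl
        right_inv := fun i => rfl }
    rw [← Matrix.det_submatrix_equiv_self e, Matrix.det_fin_two]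
    simp [e, Matrix.toSquareBlockProp_def, hCe, matAU, detF]
  · intro i hi j hj
    have hi' : 2 ≤ i.val := by omega
    have hst : ∀ a b : R, rowC k n a b i.val = rowC k n a b (i.val - 2) := by
      intro a b
      have := rowC_step k n a b (i.val - 2) (by omega)
      rwa [Nat.sub_add_cancel hi'] at this
    rw [hCe, dif_pos hi', matAU, matAU]
    by_cases h0 : j.val = 0
    · simp [h0, hst]
    · have : j.val = 1 := by omega
      simp [this, hst]

/-! ### Multi-affine polynomials as binary trees and the covering procedure -/

inductive PTree where
  | leaf : ℤ → PTree
  | node : PTree → PTree → PTree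

namespace PTree

def addc (c : ℤ) : PTree → PTree
  | leaf d => leaf (c + d)
  | node a b => node (addc c a) b

def add : PTree → PTree → PTree
  | leaf c, y => addc c y
  | node a b, leaf d => addc d (node a b)
  | node a b, node a' b' => node (add a a') (add b b')

def neg : PTree → PTree
  | leaf c => leaf (-c)
  | node a b => node (neg a) (neg b)

def eval : PTree → (ℕ → ℕ) → ℤ
  | leaf c, _ => c
  | node a b, t => eval a (fun i => t (i + 1)) + (t 0 : ℤ) * eval b (fun i => t (i + 1))

def const : PTree → ℤ
  | leaf c => c
  | node a _ => const a

def isNonneg : ℤ → Bool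
  | Int.ofNat _ => true
  | Int.negSucc _ => false

def isPos : ℤ → Bool
  | Int.ofNat 0 => false
  | Int.ofNat (_ + 1) => true
  | Int.negSucc _ => false

def nonneg : PTree → Bool
  | leaf c => isNonneg c
  | node a b => nonneg a && nonneg b

def fix : ℕ → PTree → PTree
  | _, leaf c => leaf c
  | 0, node a _ => node a (leaf 0)
  | i + 1, node a b => node (fix i a) (fix i b)

def inc : ℕ → PTree → PTree
  | _, leaf c => leaf c
  | 0, node a b => node (add a b) b
  | i + 1, node a b => node (inc i a) (inc i b)

/-- degree and first variable of a lowest-degree negative coefficient (degree `100` if none). -/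
def pick : PTree → ℕ × ℕ
  | leaf c => if isNonneg c then (100, 0) else (0, 0)
  | node a b =>
    match pick a with
    | (da, ia) => match pick b with
      | (db, _) => if Nat.ble da db then (da, ia + 1) else (db + 1, 0)

/-! Forcing combinators, so that kernel evaluation works on evaluated numerals. -/

def forceN {α : Type} : ℕ → (ℕ → α) → α
  | 0, c => c 0
  | m + 1, c => c (Nat.succ m)

def forceZ {α : Type} : ℤ → (ℤ → α) → α
  | Int.ofNat m, c => forceN m fun m => c (Int.ofNat m)
  | Int.negSucc m, c => forceN m fun m => c (Int.negSucc m)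

def forceT {α : Type} : PTree → (PTree → α) → α
  | leaf z, c => forceZ z fun z => c (leaf z)
  | node a b, c => forceT a fun a => forceT b fun b => c (node a b)

lemma forceN_eq {α : Type} (m : ℕ) (c : ℕ → α) : forceN m c = c m := by cases m <;> rfl

lemma forceZ_eq {α : Type} (m : ℤ) (c : ℤ → α) : forceZ m c = c m := by
  cases m <;> simp [forceZ, forceN_eq]

lemma forceT_eq {α : Type} (x : PTree) (c : PTree → α) : forceT x c = c x := by
  induction x generalizing c with
  | leaf z => simp [forceT, forceZ_eq]
  | node a b iha ihb => simp [forceT, iha, ihb]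

def check : ℕ → PTree → ℕ → Bool
  | 0, _, _ => false
  | f + 1, x, s =>
    match isPos (const x) with
    | false => Nat.ble s 15
    | true => match nonneg x with
      | true => true
      | false => match pick x with
        | (_, i) => check f (fix i x) s && forceT (inc i x) fun y => check f y (Nat.succ s)

lemma eval_addc (c : ℤ) (x : PTree) (t : ℕ → ℕ) : (addc c x).eval t = c + x.eval t := by
  induction x generalizing t with
  | leaf d => rfl
  | node a b iha _ => simp [addc, eval, iha]; ring

lemma eval_add (x y : PTree) (t : ℕ → ℕ) : (add x y).eval t = x.eval t + y.eval t := by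
  induction x generalizing y t with
  | leaf c => simp [add, eval_addc, eval]
  | node a b iha ihb =>
    cases y with
    | leaf d => simp only [add, eval_addc]; simp [eval]; ring
    | node a' b' => simp [add, eval, iha, ihb]; ring

lemma eval_neg (x : PTree) (t : ℕ → ℕ) : (neg x).eval t = - x.eval t := by
  induction x generalizing t with
  | leaf c => rfl
  | node a b iha ihb => simp [neg, eval, iha, ihb]; ring

lemma eval_zero (x : PTree) : x.eval (fun _ => 0) = x.const := by
  induction x with
  | leaf c => rfl
  | node a b iha _ => simp [eval, const, iha]

lemma isNonneg_iff (c : ℤ) : isNonneg c = true ↔ 0 ≤ c := by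
  cases c with
  | ofNat m => simp [isNonneg]
  | negSucc m => simp [isNonneg]

lemma isPos_iff (c : ℤ) : isPos c = true ↔ 0 < c := by
  rcases c with (_ | m) | m
  · simp [isPos]
  · simp [isPos]
    try omega
  · simp [isPos]

lemma const_le_eval (x : PTree) (h : x.nonneg = true) (t : ℕ → ℕ) :
    x.const ≤ x.eval t ∧ 0 ≤ x.eval t := by
  induction x generalizing t with
  | leaf c => simpa [eval, const, nonneg, isNonneg_iff] using h
  | node a b iha ihb =>
    simp only [nonneg, Bool.and_eq_true] at h
    have h1 := iha h.1 (fun i => t (i + 1))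
    have h2 := ihb h.2 (fun i => t (i + 1))
    have := mul_nonneg (Int.natCast_nonneg (t 0)) h2.2
    simp only [eval, const]
    constructor <;> linarith [h1.1, h1.2]

lemma eval_fix (i : ℕ) (x : PTree) (t : ℕ → ℕ) (h : t i = 0) : (fix i x).eval t = x.eval t := by
  induction x generalizing i t with
  | leaf c => cases i <;> rfl
  | node a b iha ihb =>
    cases i with
    | zero => simp [fix, eval, h]
    | succ i => simp [fix, eval, iha i (fun i => t (i + 1)) h, ihb i (fun i => t (i + 1)) h]

lemma eval_inc (i : ℕ) (x : PTree) (t u : ℕ → ℕ) (h : t i = u i + 1) (h' : ∀ j, j ≠ i → t j = u j) :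
    (inc i x).eval u = x.eval t := by
  induction x generalizing i t u with
  | leaf c => cases i <;> rfl
  | node a b iha ihb =>
    cases i with
    | zero =>
      have : (fun i => t (i + 1)) = fun i => u (i + 1) := by
        funext j; exact h' _ (by omega)
      simp [inc, eval, eval_add, h, this]; ring
    | succ i =>
      have h0 := h' 0 (by omega)
      have h1 : ∀ j, j ≠ i → t (j + 1) = u (j + 1) := fun j hj => h' _ (by omega)
      simp [inc, eval, h0, iha i (fun i => t (i + 1)) (fun i => u (i + 1)) h h1,
        ihb i (fun i => t (i + 1)) (fun i => u (i + 1)) h h1]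

theorem check_sound (k f : ℕ) : ∀ (x : PTree) (s : ℕ), check f x s = true → ∀ t : ℕ → ℕ,
    (∀ t' : ℕ → ℕ, (∀ i, t' i ≤ t i) → s + ∑ i ∈ Finset.range k, t' i ≤ 15 → 0 < x.eval t') →
    0 < x.eval t := by
  induction f with
  | zero => intro x s h; simp [check] at h
  | succ f ih =>
    intro x s h t H
    unfold check at h
    split at h
    · next hp =>
      have hs : s ≤ 15 := by simpa using h
      have := H (fun _ => 0) (by simp) (by simpa using hs)
      rw [eval_zero, ← isPos_iff] at this
      simp [hp] at this
    · next hp =>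
      rw [isPos_iff] at hp
      split at h
      · next hn => exact lt_of_lt_of_le hp (const_le_eval x hn t).1
      · split at h
        next i _ =>
        simp only [Bool.and_eq_true, forceT_eq] at h
        by_cases hti : t i = 0
        · rw [← eval_fix i x t hti]
          apply ih _ _ h.1
          intro t' ht' hs
          rw [eval_fix i x t' (by have := ht' i; omega)]
          exact H t' ht' hs
        · rw [← eval_inc i x t (Function.update t i (t i - 1)) (by simp; omega)
            (by intro j hj; simp [hj])]
          apply ih _ _ h.2
          intro u hu hs
          rw [eval_inc i x (Function.update u i (u i + 1)) u (by simp) (by intro j hj; simp [hj])]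
          apply H
          · intro j
            have := hu j
            by_cases hj : j = i
            · subst hj; simp at this ⊢; omega
            · simpa [hj] using this
          · have : ∑ j ∈ Finset.range k, Function.update u i (u i + 1) j
                ≤ ∑ j ∈ Finset.range k, u j + 1 := by
              by_cases hik : i ∈ Finset.range k
              · rw [Finset.sum_update_of_mem hik, ← Finset.sum_sdiff (Finset.singleton_subset_iff.2 hik)]
                simp; omega
              · rw [Finset.sum_update_of_notMem hik]; omega
            omega

def loopC {α : Type} : List ℤ → Bool → ℤ → ℤ → ℤ → ℤ → (ℤ → ℤ → α) → α
  | [], _, _, _, s0, s1, r => r s0 s1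
  | x :: l, true, p, c, s0, s1, r =>
    forceZ (Int.mul x c) fun y => forceZ (Int.add p y) fun c' => forceZ (Int.add s1 y) fun s1' =>
      loopC l false c c' s0 s1' r
  | x :: l, false, p, c, s0, s1, r =>
    forceZ (Int.mul x c) fun y => forceZ (Int.sub p y) fun c' => forceZ (Int.add s0 y) fun s0' =>
      forceZ (Int.add s1 y) fun s1' => loopC l true c c' s0' s1' r

def detZ : List ℤ → ℤ
  | [] => 0
  | x :: l =>
    loopC l true 1 0 x 0 fun p0 p1 => loopC l true 0 1 0 0 fun q0 q1 =>
      Int.sub (Int.mul (Int.sub 1 p0) (Int.sub 1 q1)) (Int.mul q0 p1)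

def build : ℕ → List ℤ → PTree
  | 0, l => leaf (detZ l)
  | j + 1, l => forceT (build j (l ++ [1])) fun a =>
      node a (add (build j (l ++ [2])) (neg a))

end PTree

lemma int_mul_eq (a b : ℤ) : Int.mul a b = a * b := rfl

lemma int_add_eq (a b : ℤ) : Int.add a b = a + b := rfl

lemma int_sub_eq (a b : ℤ) : Int.sub a b = a - b := rfl

lemma sumTo_succ {R : Type*} [CommRing R] (f : ℕ → R) (m : ℕ) :
    sumTo f (m + 1) = sumTo f m + f m := rfl

lemma PTree.loopC_eq {α : Type} (n : ℕ → ℤ) (a b : ℤ) (r : ℤ → ℤ → α) (l : List ℤ) :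
    ∀ t : ℕ, (∀ i, i < l.length → l.getD i 0 = n (t + 1 + i)) →
    PTree.loopC l (decide (t % 2 = 0)) (seqC n a b t).1 (seqC n a b (t + 1)).1
      (sumTo (fun s => cM ℤ 0 s * (n s * (seqC n a b s).1)) (t + 1))
      (sumTo (fun s => cM ℤ 1 s * (n s * (seqC n a b s).1)) (t + 1)) r =
    r (sumTo (fun s => cM ℤ 0 s * (n s * (seqC n a b s).1)) (t + 1 + l.length))
      (sumTo (fun s => cM ℤ 1 s * (n s * (seqC n a b s).1)) (t + 1 + l.length)) := by
  induction l with
  | nil => intro t _; simp [PTree.loopC]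
  | cons x l ih =>
    intro t h
    have hx : x = n (t + 1) := by simpa using h 0 (by simp)
    have h' : ∀ i, i < l.length → l.getD i 0 = n (t + 1 + 1 + i) := by
      intro i hi
      have := h (i + 1) (by simpa using hi)
      rw [show t + 1 + 1 + i = t + 1 + (i + 1) by ring, ← this]; rfl
    have ih := ih (t + 1) h'
    have e : t + 1 + (x :: l).length = t + 1 + 1 + l.length := by simp; omega
    rw [e, ← ih]
    have M1 : cM ℤ 1 (t + 1) = 1 := by
      have : adjC 1 (t + 1) = true := by simp [adjC]; omega
      simp [cM, this]
    rcases Nat.mod_two_eq_zero_or_one t with ht | ht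
    · have ht' : (t + 1) % 2 = 1 := by omega
      have M0 : cM ℤ 0 (t + 1) = 0 := by
        have : ¬ adjC 0 (t + 1) = true := by simp [adjC]; omega
        simp [cM, this]
      have hs := seqC_rec n a b t
      simp only [ht, ht', decide_true, PTree.loopC, PTree.forceZ_eq]
      have z : decide ((1:ℕ) = 0) = false := rfl
      rw [z, sumTo_succ _ (t + 1), sumTo_succ _ (t + 1), M0, M1, zero_mul, add_zero, one_mul, hs, ← hx]
      simp only [sgnC, ht, int_mul_eq, int_add_eq, if_true, one_mul]
    · have ht' : (t + 1) % 2 = 0 := by omega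
      have M0 : cM ℤ 0 (t + 1) = 1 := by
        have : adjC 0 (t + 1) = true := by simp [adjC]; omega
        simp [cM, this]
      have hs := seqC_rec n a b t
      have z : decide ((1:ℕ) = 0) = false := rfl
      simp only [ht, ht', z, decide_true, PTree.loopC, PTree.forceZ_eq]
      rw [sumTo_succ _ (t + 1), sumTo_succ _ (t + 1), M0, M1, one_mul, hs, ← hx]
      simp [sgnC, ht, int_sub_eq, ← sub_eq_add_neg]

lemma PTree.detZ_eq (l : List ℤ) (hl : 2 ≤ l.length) :
    PTree.detZ l = detF l.length (fun i => l.getD i 0) := by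
  cases l with
  | nil => simp at hl
  | cons x l =>
    set n : ℕ → ℤ := fun i => (x :: l).getD i 0 with hn
    have hnl : ∀ i, i < l.length → l.getD i 0 = n (0 + 1 + i) := by
      intro i _
      rw [show 0 + 1 + i = i + 1 by ring]; rfl
    have hx : n 0 = x := rfl
    have c0 : cM ℤ 0 0 = 1 := by decide
    have c1 : cM ℤ 1 0 = 0 := by decide
    have P := fun (r : ℤ → ℤ → ℤ) => PTree.loopC_eq n 1 0 r l 0 hnl
    have Q := fun (r : ℤ → ℤ → ℤ) => PTree.loopC_eq n 0 1 r l 0 hnl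
    simp only [sumTo, c0, c1, hx, seqC, Nat.zero_mod, decide_true, zero_mul, one_mul, mul_one,
      mul_zero, zero_add, add_zero] at P Q
    simp only [PTree.detZ, P, Q, detF, rowC, seqC, zero_add, zero_sub, List.length_cons, add_comm 1 l.length]
    simp only [int_mul_eq, int_sub_eq]
    ring

lemma matA_update {R : Type*} [CommRing R] (k : ℕ) (n : ℕ → R) (i : Fin k) (x : R) :
    matA k (Function.update n i.val x) =
      (matA k n).updateCol i (fun t => (if t = i then 1 else 0) + x • (- cM R t i)) := by
  ext t s
  by_cases h : s = i
  · subst h; simp [matA]; ring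
  · have : s.val ≠ i.val := fun h' => h (Fin.ext h')
    simp [matA, Matrix.updateCol_ne h, this]

lemma detF_affine {R : Type*} [CommRing R] (k : ℕ) (hk : 2 ≤ k) (n : ℕ → R) (i : ℕ) (hi : i < k) (x : R) :
    detF k (Function.update n i (1 + x)) = detF k (Function.update n i 1) +
      x * (detF k (Function.update n i 2) - detF k (Function.update n i 1)) := by
  have key : ∀ y : R, detF k (Function.update n i y) =
      ((matA k n).updateCol ⟨i, hi⟩ (fun t => (if t = ⟨i, hi⟩ then 1 else 0))).det +
       y * ((matA k n).updateCol ⟨i, hi⟩ (fun t => - cM R t i)).det := by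
    intro y
    rw [← det_matA k hk, matA_update k n ⟨i, hi⟩ y, ← Matrix.det_updateCol_smul,
      ← Matrix.det_updateCol_add]
    rfl
  rw [key, key, key]; ring

lemma PTree.eval_build (k : ℕ) (hk : 2 ≤ k) (j : ℕ) : ∀ (l : List ℤ), l.length + j = k → ∀ t : ℕ → ℕ,
    (PTree.build j l).eval t =
      detF k (fun i => if i < l.length then l.getD i 0 else if i < k then 1 + (t (i - l.length) : ℤ) else 0) := by
  induction j with
  | zero =>
    intro l hl t
    simp only [PTree.build, PTree.eval]
    have hl' : l.length = k := by simpa using hl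
    subst hl'
    rw [PTree.detZ_eq l (by omega)]
    congr 1; funext i
    by_cases h : i < l.length
    · rw [if_pos h]
    · rw [if_neg h, if_neg (by omega)]
      exact List.getD_eq_default _ _ (not_lt.1 h)
  | succ j ih =>
    intro l hl t
    simp only [PTree.build, PTree.forceT_eq, PTree.eval, PTree.eval_add, PTree.eval_neg]
    rw [ih (l ++ [1]) (by simp; omega), ih (l ++ [2]) (by simp; omega)]
    set g : ℕ → ℤ := fun i => if i < l.length then l.getD i 0 else if i < k then 1 + (t (i - l.length) : ℤ) else 0
      with hg
    have h1 : ∀ c : ℤ, (fun i => if i < (l ++ [c]).length then (l ++ [c]).getD i 0 else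
        if i < k then 1 + ((fun i => t (i + 1)) (i - (l ++ [c]).length) : ℤ) else 0)
        = Function.update g l.length c := by
      intro c; funext i
      rcases lt_trichotomy i l.length with h | h | h
      · have : i < l.length + 1 := by omega
        simp [hg, h, this, h.ne]
      · subst h; simp
      · have h' : ¬ i < l.length + 1 := by omega
        have h2 : i - (l.length + 1) + 1 = i - l.length := by omega
        simp [hg, h.ne', h', not_lt.2 h.le, h2]
    have h2 : g = Function.update g l.length (1 + (t 0 : ℤ)) := by
      funext i
      by_cases h : i = l.length
      · subst h; simp [hg]; omega
      · simp [h]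
    rw [h1, h1]
    conv_rhs => rw [h2]
    rw [detF_affine k hk g l.length (by omega)]
    ring

lemma check4 : PTree.check 60 (PTree.build 4 []) 4 = true := by decide +kernel
lemma check5 : PTree.check 60 (PTree.build 5 []) 5 = true := by decide +kernel
lemma check6 : PTree.check 60 (PTree.build 6 []) 6 = true := by decide +kernel
lemma check7 : PTree.check 60 (PTree.build 7 []) 7 = true := by decide +kernel
lemma check8 : PTree.check 60 (PTree.build 8 []) 8 = true := by decide +kernel
lemma check9 : PTree.check 60 (PTree.build 9 []) 9 = true := by decide +kernel

lemma matA_map {R S : Type*} [CommRing R] [CommRing S] (f : R →+* S) (k : ℕ) (n : ℕ → R) :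
    f.mapMatrix (matA k n) = matA k (fun i => f (n i)) := by
  ext t s
  simp [matA, cM, apply_ite f]

lemma detF_map {R S : Type*} [CommRing R] [CommRing S] (f : R →+* S) (k : ℕ) (hk : 2 ≤ k) (n : ℕ → R) :
    f (detF k n) = detF k (fun i => f (n i)) := by
  rw [← det_matA k hk, ← det_matA k hk, ← matA_map, RingHom.map_det]

lemma detF_congr {R : Type*} [CommRing R] (k : ℕ) (hk : 2 ≤ k) (n n' : ℕ → R)
    (h : ∀ i, i < k → n i = n' i) : detF k n = detF k n' := by
  rw [← det_matA k hk, ← det_matA k hk]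
  congr 1; ext t s
  simp [matA, h s s.isLt]

theorem check_all (k : ℕ) (h4 : 4 ≤ k) (h9 : k ≤ 9) :
    PTree.check 60 (PTree.build k []) k = true := by
  interval_cases k
  · exact check4
  · exact check5
  · exact check6
  · exact check7
  · exact check8
  · exact check9

theorem detF_pos_of_small (k : ℕ) (h4 : 4 ≤ k) (h9 : k ≤ 9) (N : ℕ → ℕ) (hN : ∀ i, i < k → 1 ≤ N i)
    (H : ∀ m : ℕ → ℕ, (∀ i, i < k → 1 ≤ m i ∧ m i ≤ N i) → ∑ i ∈ Finset.range k, m i ≤ 15 →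
      0 < detF k (fun i => (m i : ℤ))) :
    0 < detF k (fun i => (N i : ℤ)) := by
  have ev : ∀ t : ℕ → ℕ, (PTree.build k []).eval t = detF k (fun i => ((1 + t i : ℕ) : ℤ)) := by
    intro t
    rw [PTree.eval_build k (by omega) k [] (by simp)]
    apply detF_congr k (by omega)
    intro i hi
    simp [hi]
  have := PTree.check_sound k 60 _ k (check_all k h4 h9) (fun i => N i - 1) (by
    intro t' ht' hs
    rw [ev]
    apply H
    · intro i hi
      have h1 : t' i ≤ N i - 1 := ht' i
      have h2 := hN i hi
      omega
    · rw [Finset.sum_add_distrib]; simpa using hs)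
  rw [ev] at this
  rw [detF_congr k (by omega) _ (fun i => ((1 + (N i - 1) : ℕ) : ℤ))]
  · exact this
  · intro i hi
    have := hN i hi
    congr 1; omega

theorem base_rat : ∀ k < 10, 4 ≤ k → ∀ j < 10, 3 ≤ j → j ≤ k →
    0 < detF k (fun i => if i < j then (1 : ℚ) else (1 / 10 : ℚ)) := by
  decide +kernel

theorem base_real (k : ℕ) (h4 : 4 ≤ k) (h9 : k ≤ 9) (j : ℕ) (h3 : 3 ≤ j) (hj : j ≤ k) :
    0 < detF k (fun i => if i < j then (1 : ℝ) else (1 / 10 : ℝ)) := by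
  have := base_rat k (by omega) h4 j (by omega) h3 hj
  have h2 : (0 : ℝ) < ((Rat.castHom ℝ) (detF k (fun i => if i < j then (1 : ℚ) else (1 / 10 : ℚ)))) := by
    simpa using this
  rw [detF_map _ k (by omega)] at h2
  convert h2 using 2
  funext i
  split_ifs <;> simp

/-! ### Quadratic forms and eigenvalue counts -/

section LinAlg

variable {ι : Type*} [Fintype ι]

/-- there is a subspace of dimension at least `d` on which the form of `A` is nonnegative -/
def NN (A : Matrix ι ι ℝ) (d : ℕ) : Prop :=
  ∃ W : Submodule ℝ (ι → ℝ), d ≤ Module.finrank ℝ W ∧ ∀ x ∈ W, 0 ≤ x ⬝ᵥ A *ᵥ x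

lemma exists_diag [DecidableEq ι] (A : Matrix ι ι ℝ) (hA : A.IsHermitian) :
    ∃ φ : (ι → ℝ) ≃ₗ[ℝ] (ι → ℝ), ∀ x, x ⬝ᵥ A *ᵥ x = ∑ i, hA.eigenvalues i * (φ x i) ^ 2 := by
  set U : Matrix ι ι ℝ := (hA.eigenvectorUnitary : Matrix ι ι ℝ) with hU
  have h1 : U * star U = 1 := Unitary.coe_mul_star_self hA.eigenvectorUnitary
  have h2 : star U * U = 1 := Unitary.coe_star_mul_self hA.eigenvectorUnitary
  refine ⟨Matrix.toLin'OfInv h1 h2, fun x => ?_⟩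
  have hs : A = U * Matrix.diagonal hA.eigenvalues * star U := by
    have := hA.spectral_theorem
    rw [Unitary.conjStarAlgAut_apply] at this
    simpa using this
  have hst : star U = Uᵀ := by
    rw [Matrix.star_eq_conjTranspose, Matrix.conjTranspose_eq_transpose_of_trivial]
  have : x ⬝ᵥ A *ᵥ x = (star U *ᵥ x) ⬝ᵥ (Matrix.diagonal hA.eigenvalues *ᵥ (star U *ᵥ x)) := by
    conv_lhs => rw [hs]
    rw [← Matrix.mulVec_mulVec, ← Matrix.mulVec_mulVec, Matrix.dotProduct_mulVec, ← Matrix.mulVec_transpose,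
      ← hst]
  rw [this]
  simp only [dotProduct, Matrix.mulVec_diagonal]
  apply Finset.sum_congr rfl
  intro i _
  have : (Matrix.toLin'OfInv h1 h2) x = star U *ᵥ x := by simp [Matrix.toLin'OfInv]
  rw [this]; ring

lemma card_of_NN [DecidableEq ι] (A : Matrix ι ι ℝ) (hA : A.IsHermitian) (d : ℕ) (h : NN A d) :
    d ≤ (Finset.univ.filter fun i => 0 ≤ hA.eigenvalues i).card := by
  obtain ⟨W, hd, hW⟩ := h
  obtain ⟨φ, hφ⟩ := exists_diag A hA
  refine hd.trans ?_
  let g : W →ₗ[ℝ] ({i // 0 ≤ hA.eigenvalues i} → ℝ) :=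
    (LinearMap.funLeft ℝ ℝ (Subtype.val)) ∘ₗ φ.toLinearMap ∘ₗ W.subtype
  have hg : Function.Injective g := by
    rw [injective_iff_map_eq_zero]
    rintro ⟨x, hx⟩ h0
    have h0' : ∀ i, 0 ≤ hA.eigenvalues i → φ x i = 0 := by
      intro i hi
      exact congrFun h0 ⟨i, hi⟩
    have h1 := hW x hx
    rw [hφ] at h1
    have h2 : ∀ i ∈ Finset.univ, hA.eigenvalues i * (φ x i) ^ 2 ≤ 0 := by
      intro i _
      by_cases hi : 0 ≤ hA.eigenvalues i
      · simp [h0' i hi]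
      · exact mul_nonpos_of_nonpos_of_nonneg (not_le.1 hi).le (sq_nonneg _)
    have h3 := (Finset.sum_eq_zero_iff_of_nonpos h2).1 (le_antisymm (Finset.sum_nonpos h2) h1)
    have h4 : φ x = 0 := by
      funext i
      by_cases hi : 0 ≤ hA.eigenvalues i
      · exact h0' i hi
      · have := h3 i (Finset.mem_univ _)
        rcases mul_eq_zero.1 this with h | h
        · exact absurd h.ge hi
        · simpa using h
    have : x = 0 := by simpa using h4
    simpa using this
  have := LinearMap.finrank_le_finrank_of_injective hg
  rwa [Module.finrank_fintype_fun_eq_card, Fintype.card_subtype] at this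

lemma card_of_pos [DecidableEq ι] (A : Matrix ι ι ℝ) (hA : A.IsHermitian) (W : Submodule ℝ (ι → ℝ))
    (hW : ∀ x ∈ W, x ≠ 0 → 0 < x ⬝ᵥ A *ᵥ x) :
    Module.finrank ℝ W ≤ (Finset.univ.filter fun i => 0 < hA.eigenvalues i).card := by
  obtain ⟨φ, hφ⟩ := exists_diag A hA
  let g : W →ₗ[ℝ] ({i // 0 < hA.eigenvalues i} → ℝ) :=
    (LinearMap.funLeft ℝ ℝ (Subtype.val)) ∘ₗ φ.toLinearMap ∘ₗ W.subtype
  have hg : Function.Injective g := by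
    rw [injective_iff_map_eq_zero]
    rintro ⟨x, hx⟩ h0
    have h0' : ∀ i, 0 < hA.eigenvalues i → φ x i = 0 := by
      intro i hi
      exact congrFun h0 ⟨i, hi⟩
    by_contra hne
    have h1 := hW x hx (by simpa using hne)
    rw [hφ] at h1
    have h2 : ∀ i ∈ Finset.univ, hA.eigenvalues i * (φ x i) ^ 2 ≤ 0 := by
      intro i _
      by_cases hi : 0 < hA.eigenvalues i
      · simp [h0' i hi]
      · exact mul_nonpos_of_nonpos_of_nonneg (not_lt.1 hi) (sq_nonneg _)
    exact absurd h1 (not_lt.2 (Finset.sum_nonpos h2))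
  have := LinearMap.finrank_le_finrank_of_injective hg
  rwa [Module.finrank_fintype_fun_eq_card, Fintype.card_subtype] at this

lemma NN_of_card [DecidableEq ι] (A : Matrix ι ι ℝ) (hA : A.IsHermitian) (d : ℕ)
    (h : d ≤ (Finset.univ.filter fun i => 0 ≤ hA.eigenvalues i).card) : NN A d := by
  obtain ⟨φ, hφ⟩ := exists_diag A hA
  let E : ({i // 0 ≤ hA.eigenvalues i} → ℝ) →ₗ[ℝ] (ι → ℝ) :=
    { toFun := fun c i => if h : 0 ≤ hA.eigenvalues i then c ⟨i, h⟩ else 0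
      map_add' := by
        intro a b; funext i; by_cases h : 0 ≤ hA.eigenvalues i <;> simp [h]
      map_smul' := by
        intro a b; funext i; by_cases h : 0 ≤ hA.eigenvalues i <;> simp [h] }
  have hE : Function.Injective E := by
    intro a b hab
    funext i
    have := congrFun hab i.1
    simpa [E, i.2] using this
  let G := φ.symm.toLinearMap ∘ₗ E
  have hG : Function.Injective G := φ.symm.injective.comp hE
  refine ⟨LinearMap.range G, ?_, ?_⟩
  · rw [LinearMap.finrank_range_of_inj hG, Module.finrank_fintype_fun_eq_card, Fintype.card_subtype]
    exact h
  · rintro _ ⟨c, rfl⟩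
    rw [hφ]
    apply Finset.sum_nonneg
    intro i _
    by_cases hi : 0 ≤ hA.eigenvalues i
    · exact mul_nonneg hi (sq_nonneg _)
    · simp [G, E, hi]

lemma NN_step (A B : Matrix ι ι ℝ) (i : ι) (hAB : ∀ x : ι → ℝ, x i = 0 → x ⬝ᵥ A *ᵥ x = x ⬝ᵥ B *ᵥ x)
    (d : ℕ) (h : NN A (d + 1)) : NN B d := by
  obtain ⟨W, hd, hW⟩ := h
  let f : W →ₗ[ℝ] ℝ := (LinearMap.proj i) ∘ₗ W.subtype
  refine ⟨(LinearMap.ker f).map W.subtype, ?_, ?_⟩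
  · rw [Submodule.finrank_map_subtype_eq]
    have h1 := LinearMap.finrank_range_add_finrank_ker f
    have h2 : Module.finrank ℝ (LinearMap.range f) ≤ 1 := by
      simpa using Submodule.finrank_le (LinearMap.range f)
    omega
  · rintro _ ⟨x, hx, rfl⟩
    have : (x : ι → ℝ) i = 0 := hx
    change 0 ≤ (x : ι → ℝ) ⬝ᵥ B *ᵥ (x : ι → ℝ)
    rw [← hAB _ this]
    exact hW _ x.2

lemma det_neg_eq [DecidableEq ι] (A : Matrix ι ι ℝ) (hA : A.IsHermitian) :
    (-A).det = ∏ i, (- hA.eigenvalues i) := by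
  rw [Matrix.det_neg, hA.det_eq_prod_eigenvalues, Finset.prod_neg]
  simp

lemma det_nonpos [DecidableEq ι] (A : Matrix ι ι ℝ) (hA : A.IsHermitian) (h3 : NN A 3) (h4 : ¬ NN A 4) :
    (-A).det ≤ 0 := by
  have a := card_of_NN A hA 3 h3
  have b : ¬ 4 ≤ (Finset.univ.filter fun i => 0 ≤ hA.eigenvalues i).card := fun h => h4 (NN_of_card A hA 4 h)
  have c : (Finset.univ.filter fun i => 0 ≤ hA.eigenvalues i).card = 3 := by omega
  rw [det_neg_eq A hA, ← Finset.prod_filter_mul_prod_filter_not Finset.univ (fun i => 0 ≤ hA.eigenvalues i)]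
  apply mul_nonpos_of_nonpos_of_nonneg
  · rw [Finset.prod_neg, c]
    have : 0 ≤ ∏ i with 0 ≤ hA.eigenvalues i, hA.eigenvalues i :=
      Finset.prod_nonneg fun i hi => (Finset.mem_filter.1 hi).2
    linarith
  · apply Finset.prod_nonneg
    intro i hi
    have := (Finset.mem_filter.1 hi).2
    linarith

lemma det_pos' [DecidableEq ι] (A : Matrix ι ι ℝ) (hA : A.IsHermitian) (h3 : ¬ NN A 3)
    (W : Submodule ℝ (ι → ℝ)) (hd : 2 ≤ Module.finrank ℝ W)
    (hW : ∀ x ∈ W, x ≠ 0 → 0 < x ⬝ᵥ A *ᵥ x) : 0 < (-A).det := by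
  have b : ¬ 3 ≤ (Finset.univ.filter fun i => 0 ≤ hA.eigenvalues i).card := fun h => h3 (NN_of_card A hA 3 h)
  have a := hd.trans (card_of_pos A hA W hW)
  have hsub : (Finset.univ.filter fun i => 0 < hA.eigenvalues i) ⊆
      (Finset.univ.filter fun i => 0 ≤ hA.eigenvalues i) := by
    intro i; simp only [Finset.mem_filter]; exact fun h => ⟨h.1, h.2.le⟩
  have e := Finset.eq_of_subset_of_card_le hsub (by omega)
  have c : (Finset.univ.filter fun i => 0 < hA.eigenvalues i).card = 2 := by
    have := Finset.card_le_card hsub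
    omega
  rw [det_neg_eq A hA, ← Finset.prod_filter_mul_prod_filter_not Finset.univ (fun i => 0 < hA.eigenvalues i)]
  apply mul_pos
  · rw [Finset.prod_neg, c]
    have : 0 < ∏ i with 0 < hA.eigenvalues i, hA.eigenvalues i :=
      Finset.prod_pos fun i hi => (Finset.mem_filter.1 hi).2
    linarith
  · apply Finset.prod_pos
    intro i hi
    have h1 := (Finset.mem_filter.1 hi).2
    have h2 : ¬ 0 ≤ hA.eigenvalues i := by
      intro h
      have : i ∈ (Finset.univ.filter fun i => 0 ≤ hA.eigenvalues i) := by simp [h]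
      rw [← e] at this
      exact h1 (Finset.mem_filter.1 this).2
    linarith

end LinAlg

/-! ### The reduced form `M - diag d` -/

def matT (k : ℕ) (d : ℕ → ℝ) : Matrix (Fin k) (Fin k) ℝ :=
  Matrix.of fun t s => cM ℝ t s - if t = s then d t else 0

lemma matT_herm (k : ℕ) (d : ℕ → ℝ) : (matT k d).IsHermitian := by
  rw [Matrix.IsHermitian, Matrix.conjTranspose_eq_transpose_of_trivial]
  ext t s
  by_cases h : s = t
  · subst h; simp [matT]
  · simp [matT, cM_symm ℝ s t, h, Ne.symm h]

lemma matT_qf (k : ℕ) (d : ℕ → ℝ) (x : Fin k → ℝ) :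
    x ⬝ᵥ matT k d *ᵥ x = ∑ t : Fin k, ∑ s : Fin k, cM ℝ t s * (x t * x s) - ∑ t : Fin k, d t * (x t) ^ 2 := by
  simp only [dotProduct, Matrix.mulVec, matT, Matrix.of_apply, sub_mul, Finset.sum_sub_distrib, ite_mul,
    zero_mul, Finset.sum_ite_eq, Finset.mem_univ, if_true, mul_sub, Finset.mul_sum]
  congr 1
  · refine Finset.sum_congr rfl fun t _ => Finset.sum_congr rfl fun s _ => by ring
  · refine Finset.sum_congr rfl fun t _ => by ring

lemma matT_congr (k : ℕ) (d d' : ℕ → ℝ) (h : ∀ i, i < k → d i = d' i) : matT k d = matT k d' := by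
  ext t s; simp [matT, h t t.isLt]

lemma matT_det (k : ℕ) (hk : 2 ≤ k) (n : ℕ → ℝ) (hn : ∀ i, i < k → 0 < n i) :
    ∃ c : ℝ, 0 < c ∧ detF k n = (-(matT k fun i => (n i)⁻¹)).det * c := by
  refine ⟨∏ i : Fin k, n i, Finset.prod_pos fun i _ => hn i i.isLt, ?_⟩
  rw [← det_matA k hk, ← Matrix.det_diagonal, ← Matrix.det_mul]
  congr 1
  ext t s
  rw [Matrix.mul_diagonal]
  have := (hn s s.isLt).ne'
  by_cases h : t = s
  · subst h; simp [matA, matT]; field_simp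
  · simp [matA, matT, h]

lemma matT_step (k : ℕ) (d d' : ℕ → ℝ) (i : Fin k) (h : ∀ j, j < k → j ≠ i.val → d j = d' j) (e : ℕ)
    (hn : ¬ NN (matT k d') e) : ¬ NN (matT k d) (e + 1) := by
  intro H
  apply hn
  refine NN_step _ _ i ?_ e H
  intro x hx
  rw [matT_qf, matT_qf]
  congr 1
  apply Finset.sum_congr rfl
  intro j _
  by_cases hj : j = i
  · subst hj; simp [hx]
  · rw [h j j.isLt (fun h' => hj (Fin.ext h'))]

lemma matT_step_det (k : ℕ) (hk : 2 ≤ k) (n : ℕ → ℝ) (hpos : ∀ i, i < k → 0 < n i) (d' : ℕ → ℝ) (i : Fin k)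
    (h : ∀ j, j < k → j ≠ i.val → (n j)⁻¹ = d' j)
    (hn : ¬ NN (matT k d') 3) (hF : 0 < detF k n) : ¬ NN (matT k fun j => (n j)⁻¹) 3 := by
  intro H
  have h4 := matT_step k (fun j => (n j)⁻¹) d' i h 3 hn
  have := det_nonpos _ (matT_herm k _) H h4
  obtain ⟨c, hc, he⟩ := matT_det k hk n hpos
  rw [he] at hF
  nlinarith [mul_nonneg (neg_nonneg.2 this) hc.le]

lemma matT_base0 (k : ℕ) (h9 : k ≤ 9) : ¬ NN (matT k fun _ => 10) 1 := by
  rintro ⟨W, hd, hW⟩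
  have : Nontrivial W := Module.nontrivial_of_finrank_pos (R := ℝ) (by omega)
  obtain ⟨⟨x, hx⟩, hne⟩ := exists_ne (0 : W)
  have hx0 : x ≠ 0 := fun h => hne (by ext1; exact h)
  have h1 := hW x hx
  rw [matT_qf] at h1
  have h2 : ∑ t : Fin k, ∑ s : Fin k, cM ℝ t s * (x t * x s) ≤ ∑ t : Fin k, ∑ s : Fin k, ((x t)^2 + (x s)^2) / 2 := by
    refine Finset.sum_le_sum fun t _ => Finset.sum_le_sum fun s _ => ?_
    unfold cM
    split_ifs
    · nlinarith [sq_nonneg (x t - x s)]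
    · nlinarith [sq_nonneg (x t), sq_nonneg (x s)]
  have h3 : ∑ t : Fin k, ∑ s : Fin k, ((x t)^2 + (x s)^2) / 2 = k * ∑ t, (x t)^2 := by
    simp only [add_div, Finset.sum_add_distrib, Finset.sum_const, Finset.card_univ, Fintype.card_fin,
      ← Finset.sum_div, nsmul_eq_mul, ← Finset.mul_sum]
    ring
  have h4 : 0 < ∑ t, (x t)^2 := by
    obtain ⟨i, hi⟩ := Function.ne_iff.1 hx0
    exact Finset.sum_pos' (fun _ _ => sq_nonneg _) ⟨i, Finset.mem_univ _, by
      have : x i ≠ 0 := hi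
      positivity⟩
  rw [← Finset.mul_sum] at h1
  have h5 : (k : ℝ) ≤ 9 := by exact_mod_cast h9
  nlinarith

lemma matT_base (k : ℕ) (h4 : 4 ≤ k) (h9 : k ≤ 9) : ¬ NN (matT k fun _ => 1) 3 := by
  let d : ℕ → ℕ → ℝ := fun j i => if i < j then 1 else 10
  have hd0 : ¬ NN (matT k (d 0)) 1 := by simpa [d] using matT_base0 k h9
  have hag : ∀ j : ℕ, ∀ i, i ≠ j → d (j + 1) i = d j i := by
    intro j i hi
    have : i < j + 1 ↔ i < j := by omega
    simp [d, this]
  have hd1 : ¬ NN (matT k (d 1)) 2 :=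
    matT_step k _ _ ⟨0, by omega⟩ (fun j _ h => hag 0 j h) 1 hd0
  have hd2 : ¬ NN (matT k (d 2)) 3 :=
    matT_step k _ _ ⟨1, by omega⟩ (fun j _ h => hag 1 j h) 2 hd1
  have hind : ∀ j, 2 ≤ j → j ≤ k → ¬ NN (matT k (d j)) 3 := by
    intro j hj
    induction j, hj using Nat.le_induction with
    | base => exact fun _ => hd2
    | succ j hj ih =>
      intro hjk
      have hF := base_real k h4 h9 (j + 1) (by omega) hjk
      have e : (fun i => (if i < j + 1 then (1 : ℝ) else (1 / 10 : ℝ))⁻¹) = d (j + 1) := by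
        funext i; simp only [d]; split_ifs <;> norm_num
      have := matT_step_det k (by omega) _ (fun i _ => by split_ifs <;> norm_num) (d j) ⟨j, by omega⟩ (by
        intro i _ hi
        rw [← hag j i hi, ← e]) (ih (by omega)) hF
      rwa [e] at this
  have := hind k (by omega) le_rfl
  rwa [matT_congr k (d k) (fun _ => 1) (fun i hi => by simp [d, hi])] at this

lemma not_NN_of_pos (k : ℕ) (h4 : 4 ≤ k) (h9 : k ≤ 9) (s : ℕ) : ∀ N : ℕ → ℕ, ∑ i ∈ Finset.range k, N i = s →
    (∀ i, i < k → 1 ≤ N i) →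
    (∀ m : ℕ → ℕ, (∀ i, i < k → 1 ≤ m i ∧ m i ≤ N i) → 0 < detF k (fun i => (m i : ℤ))) →
    ¬ NN (matT k fun i => ((N i : ℝ))⁻¹) 3 := by
  induction s with
  | zero =>
    intro N hs hN
    have := (Finset.sum_eq_zero_iff.1 hs) 0 (by simp; omega)
    have := hN 0 (by omega)
    omega
  | succ s ih =>
    intro N hs hN H
    by_cases h1 : ∀ i, i < k → N i = 1
    · rw [matT_congr k _ (fun _ => 1) (fun i hi => by simp [h1 i hi])]
      exact matT_base k h4 h9
    · push Not at h1
      obtain ⟨i, hi, hne⟩ := h1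
      have h2 : 2 ≤ N i := by have := hN i hi; omega
      have hF : 0 < detF k (fun i => (N i : ℝ)) := by
        have := H N (fun i hi => ⟨hN i hi, le_rfl⟩)
        have h' : (0 : ℝ) < (Int.castRingHom ℝ) (detF k (fun i => (N i : ℤ))) := by
          simpa using this
        rw [detF_map _ k (by omega)] at h'
        simpa using h'
      refine matT_step_det k (by omega) (fun i => (N i : ℝ)) (fun i hi => by exact_mod_cast hN i hi)
        (fun j => ((Function.update N i (N i - 1) j : ℕ) : ℝ)⁻¹) ⟨i, hi⟩ ?_ ?_ hF
      · intro j _ hj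
        have hj' : j ≠ i := hj
        simp [hj']
      · apply ih (Function.update N i (N i - 1))
        · have hik : i ∈ Finset.range k := by simpa using hi
          rw [Finset.sum_update_of_mem hik]
          rw [← Finset.sum_sdiff (Finset.singleton_subset_iff.2 hik)] at hs
          simp at hs ⊢; omega
        · intro j hj
          by_cases h : j = i
          · subst h; simp; omega
          · simpa [h] using hN j hj
        · intro m hm
          apply H
          intro j hj
          refine ⟨(hm j hj).1, (hm j hj).2.trans ?_⟩
          by_cases h : j = i
          · subst h; simp
          · simp [h]

lemma NN_of_nonpos (k : ℕ) (h4 : 4 ≤ k) (m : ℕ → ℕ) (hm : ∀ i, i < k → 1 ≤ m i)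
    (hF : detF k (fun i => (m i : ℤ)) ≤ 0) : NN (matT k fun i => ((m i : ℝ))⁻¹) 3 := by
  by_contra hNN
  have hF' : detF k (fun i => (m i : ℝ)) ≤ 0 := by
    have h' : (Int.castRingHom ℝ) (detF k (fun i => (m i : ℤ))) ≤ (0 : ℝ) := by
      simpa using hF
    rw [detF_map _ k (by omega)] at h'
    simpa using h'
  let E : (Fin 2 → ℝ) →ₗ[ℝ] (Fin k → ℝ) :=
    { toFun := fun c i => if i.val = 0 ∨ i.val = 2 then c 0 else if i.val = 1 ∨ i.val = 3 then c 1 else 0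
      map_add' := by
        intro a b; funext i; simp only [Pi.add_apply]; split_ifs <;> simp
      map_smul' := by
        intro a b; funext i; simp only [Pi.smul_apply]; split_ifs <;> simp }
  have hE : Function.Injective E := by
    intro a b hab
    have h0 := congrFun hab ⟨0, by omega⟩
    have h1 := congrFun hab ⟨1, by omega⟩
    simp [E] at h0 h1
    funext i; fin_cases i
    · exact h0
    · exact h1
  have := det_pos' (matT k fun i => ((m i : ℝ))⁻¹) (matT_herm k _) hNN (LinearMap.range E)
    (by rw [LinearMap.finrank_range_of_inj hE]; simp) (by
      rintro _ ⟨c, rfl⟩ hne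
      have hc : c ≠ 0 := by rintro rfl; simp at hne
      have hc' : 0 < (c 0) ^ 2 + (c 1) ^ 2 := by
        by_contra h
        apply hc
        funext i; fin_cases i
        · show c 0 = 0
          nlinarith [sq_nonneg (c 0), sq_nonneg (c 1)]
        · show c 1 = 0
          nlinarith [sq_nonneg (c 0), sq_nonneg (c 1)]
      rw [matT_qf]
      have hle : ∑ t : Fin k, (m t : ℝ)⁻¹ * (E c t) ^ 2 ≤ ∑ t : Fin k, (E c t) ^ 2 := by
        apply Finset.sum_le_sum
        intro t _
        have h1 : (1 : ℝ) ≤ m t := by exact_mod_cast hm t t.isLt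
        have := inv_le_one_of_one_le₀ h1
        nlinarith [sq_nonneg (E c t)]
      have hsum : ∀ g : ℕ → ℝ, (∀ i, 4 ≤ i → g i = 0) → ∑ t : Fin k, g t = g 0 + g 1 + g 2 + g 3 := by
        intro g hg
        rw [Fin.sum_univ_eq_sum_range g k, ← Finset.sum_subset (Finset.range_subset_range.2 h4)]
        · simp [Finset.sum_range_succ]
        · intro i _ hi
          exact hg i (by simpa using hi)
      let e : ℕ → ℝ := fun i => if i = 0 ∨ i = 2 then c 0 else if i = 1 ∨ i = 3 then c 1 else 0
      have he : ∀ t : Fin k, E c t = e t := fun t => rfl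
      have he0 : e 0 = c 0 := by simp [e]
      have he1 : e 1 = c 1 := by simp [e]
      have he2 : e 2 = c 0 := by simp [e]
      have he3 : e 3 = c 1 := by simp [e]
      have he4 : ∀ i, 4 ≤ i → e i = 0 := by
        intro i hi
        have : ¬ (i = 0 ∨ i = 2) := by omega
        have : ¬ (i = 1 ∨ i = 3) := by omega
        simp [e, *]
      have e1 : ∑ t : Fin k, (E c t) ^ 2 = 2 * (c 0) ^ 2 + 2 * (c 1) ^ 2 := by
        simp only [he]
        rw [hsum (fun t => (e t) ^ 2) (fun i hi => by simp [he4 i hi]), he0, he1, he2, he3]; ring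
      have e2 : ∑ t : Fin k, ∑ s : Fin k, cM ℝ t s * (E c t * E c s) =
          4 * (c 0) ^ 2 + 4 * (c 1) ^ 2 + 2 * (c 0 * c 1) := by
        simp only [he]
        rw [hsum (fun t => ∑ s : Fin k, cM ℝ t s * (e t * e s)) (fun i hi => by simp [he4 i hi])]
        rw [hsum (fun s => cM ℝ 0 s * (e 0 * e s)) (fun i hi => by simp [he4 i hi]),
          hsum (fun s => cM ℝ 1 s * (e 1 * e s)) (fun i hi => by simp [he4 i hi]),
          hsum (fun s => cM ℝ 2 s * (e 2 * e s)) (fun i hi => by simp [he4 i hi]),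
          hsum (fun s => cM ℝ 3 s * (e 3 * e s)) (fun i hi => by simp [he4 i hi]), he0, he1, he2, he3]
        simp [cM, adjC]; ring
      rw [e2]
      nlinarith [sq_nonneg (c 0 + c 1)])
  obtain ⟨c, hc, he⟩ := matT_det k (by omega) (fun i => (m i : ℝ)) (fun i hi => by exact_mod_cast hm i hi)
  rw [he] at hF'
  nlinarith [mul_pos this hc]

lemma NN_mono (k : ℕ) (m m' : ℕ → ℕ) (hm : ∀ i, i < k → 1 ≤ m i ∧ m i ≤ m' i) (e : ℕ)
    (h : NN (matT k fun i => ((m i : ℝ))⁻¹) e) : NN (matT k fun i => ((m' i : ℝ))⁻¹) e := by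
  obtain ⟨W, hd, hW⟩ := h
  refine ⟨W, hd, fun x hx => (hW x hx).trans ?_⟩
  rw [matT_qf, matT_qf]
  apply sub_le_sub_left
  apply Finset.sum_le_sum
  intro t _
  have h1 := hm t t.isLt
  have h2 : (0 : ℝ) < m t := by exact_mod_cast h1.1
  have h3 : (m t : ℝ) ≤ m' t := by exact_mod_cast h1.2
  have := inv_anti₀ h2 h3
  exact mul_le_mul_of_nonneg_right this (sq_nonneg _)

/-! ### Assembly -/

lemma getD_two_iff (l : List ℝ) (hl : l.Pairwise (fun a b => b ≤ a)) (h3 : 3 ≤ l.length) :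
    0 ≤ l.getD 2 0 ↔ 3 ≤ l.countP (fun x => decide (0 ≤ x)) := by
  match l, hl, h3 with
  | a :: b :: c :: r, hl, _ =>
    simp only [List.pairwise_cons, List.mem_cons, forall_eq_or_imp] at hl
    obtain ⟨⟨hab, hac, _⟩, ⟨hbc, _⟩, hc, _⟩ := hl
    have e : (a :: b :: c :: r).getD 2 0 = c := rfl
    rw [e]
    constructor
    · intro h
      have h1 : 0 ≤ b := h.trans hbc
      have h2 : 0 ≤ a := h.trans hac
      simp [List.countP_cons, h, h1, h2]
    · intro h
      by_contra hn
      have hr : r.countP (fun x => decide (0 ≤ x)) = 0 := by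
        rw [List.countP_eq_zero]
        intro x hx
        have := hc x hx
        simp only [decide_eq_true_eq, not_le]
        linarith [not_le.1 hn]
      simp only [List.countP_cons, hr, hn] at h
      have u1 : (if decide (0 ≤ b) = true then 1 else 0) ≤ 1 := by split_ifs <;> simp
      have u2 : (if decide (0 ≤ a) = true then 1 else 0) ≤ 1 := by split_ifs <;> simp
      simp at h
      split_ifs at h <;> omega

lemma lam_three_iff [Fintype V] [DecidableEq V] (G : SimpleGraph V) (h3 : 3 ≤ Fintype.card V) :
    0 ≤ lam G 3 ↔ NN (adjMat G) 3 := by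
  have key : 0 ≤ lam G 3 ↔ 3 ≤ (Finset.univ.filter fun i => 0 ≤ (adjMat_isHermitian G).eigenvalues i).card := by
    unfold lam
    have e1 : Fintype.ofFinite V = ‹Fintype V› := Subsingleton.elim _ _
    have e2 : Classical.decEq V = ‹DecidableEq V› := Subsingleton.elim _ _
    rw [e1, e2]
    show 0 ≤ List.getD _ 2 0 ↔ _
    rw [getD_two_iff]
    · rw [List.countP_reverse, ← Multiset.coe_countP, Multiset.sort_eq, Multiset.countP_map]
      rfl
    · rw [List.pairwise_reverse]
      exact Multiset.pairwise_sort _ _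
    · simpa using h3
  rw [key]
  exact ⟨NN_of_card _ _ 3, card_of_NN _ _ 3⟩

/-- position in the chain ordering -/
def cI (k : ℕ) : Fin ((k + 1) / 2) ⊕ Fin (k / 2) → Fin k
  | Sum.inl i => ⟨2 * (i : ℕ), by have := i.isLt; omega⟩
  | Sum.inr j => ⟨2 * (k / 2 - 1 - (j : ℕ)) + 1, by have := j.isLt; omega⟩

lemma cI_bij (k : ℕ) : Function.Bijective (cI k) := by
  rw [Fintype.bijective_iff_injective_and_card]
  constructor
  · rintro (i | i) (j | j) h <;> simp only [cI, Fin.mk.injEq] at h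
    · congr 1; ext; omega
    · omega
    · omega
    · have := i.isLt
      have := j.isLt
      congr 1; ext; omega
  · simp; omega

lemma toIdx_bij (k : ℕ) : Function.Bijective (toIdx (k := k)) := by
  rw [Fintype.bijective_iff_injective_and_card]
  constructor
  · rintro (i | i) (j | j) h <;> simp only [toIdx, Fin.mk.injEq] at h
    · congr 1; ext; omega
    · have := i.isLt
      omega
    · have := j.isLt
      omega
    · congr 1; ext; omega
  · simp; omega

lemma oboudi_cM (k : ℕ) (a b : Fin ((k + 1) / 2) ⊕ Fin (k / 2)) :
    (a = b ∨ (oboudi k).Adj a b) ↔ adjC (cI k a) (cI k b) = true := by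
  have h2 : ∀ t s : ℕ, adjC t s = true ↔ (t % 2 = s % 2 ∨ (t % 2 = 0 ∧ s < t) ∨ (s % 2 = 0 ∧ t < s)) := by
    intro t s
    simp [adjC, or_assoc]
  rw [h2]
  unfold oboudi
  rw [SimpleGraph.fromRel_adj]
  rcases a with i | i <;> rcases b with j | j <;> simp only [cI] <;> have := i.isLt <;> have := j.isLt
  · simp; tauto
  · simp; omega
  · simp; omega
  · have h : (2 * (k / 2 - 1 - (i : ℕ)) + 1) % 2 = (2 * (k / 2 - 1 - (j : ℕ)) + 1) % 2 := by omega
    simp only [h, true_or, iff_true]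
    tauto

lemma adjMat_bGraph (k : ℕ) (nn : Fin k → ℕ)
    (p q : Σ v : Fin ((k + 1) / 2) ⊕ Fin (k / 2), Fin (nn (toIdx v))) :
    adjMat (bGraph k nn) p q = cM ℝ (cI k p.1) (cI k q.1) - if p = q then 1 else 0 := by
  unfold adjMat
  rw [SimpleGraph.adjMatrix_apply]
  have : (bGraph k nn).Adj p q ↔ p ≠ q ∧ adjC (cI k p.1) (cI k q.1) = true := by
    rw [← oboudi_cM]
    unfold bGraph lexProd
    rw [SimpleGraph.fromRel_adj, SimpleGraph.adj_comm _ q.1 p.1]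
    tauto
  unfold cM
  by_cases h : p = q
  · subst h
    have : adjC (cI k p.1) (cI k p.1) = true := by simp [adjC]
    simp [this]
  · simp [this, h]

/-- the class sizes read along the chain -/
noncomputable def chainN (k : ℕ) (nn : Fin k → ℕ) (t : ℕ) : ℕ :=
  if h : t < k then nn (toIdx ((Equiv.ofBijective _ (cI_bij k)).symm ⟨t, h⟩)) else 1

lemma chainN_cI (k : ℕ) (nn : Fin k → ℕ) (v) : chainN k nn (cI k v) = nn (toIdx v) := by
  unfold chainN
  rw [dif_pos (cI k v).isLt]
  have : (Equiv.ofBijective _ (cI_bij k)).symm ⟨(cI k v).val, (cI k v).isLt⟩ = v := by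
    rw [Equiv.symm_apply_eq]; rfl
  rw [this]

lemma adjMat_qf (k : ℕ) (nn : Fin k → ℕ)
    (x : (Σ v : Fin ((k + 1) / 2) ⊕ Fin (k / 2), Fin (nn (toIdx v))) → ℝ) :
    x ⬝ᵥ adjMat (bGraph k nn) *ᵥ x =
      ∑ u, ∑ v, cM ℝ (cI k u) (cI k v) * ((∑ i, x ⟨u, i⟩) * (∑ j, x ⟨v, j⟩)) - ∑ u, ∑ i, (x ⟨u, i⟩) ^ 2 := by
  simp only [dotProduct, Matrix.mulVec, adjMat_bGraph, sub_mul, Finset.sum_sub_distrib, ite_mul,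
    zero_mul, one_mul, Finset.sum_ite_eq, Finset.mem_univ, if_true, mul_sub, Finset.mul_sum]
  congr 1
  · rw [Fintype.sum_sigma]
    refine Finset.sum_congr rfl fun u _ => ?_
    simp only [Fintype.sum_sigma]
    rw [Finset.sum_comm]
    refine Finset.sum_congr rfl fun v _ => ?_
    rw [Finset.sum_comm]
    refine Finset.sum_congr rfl fun j _ => ?_
    rw [Finset.sum_mul, Finset.mul_sum]
    refine Finset.sum_congr rfl fun i _ => ?_
    ring
  · rw [Fintype.sum_sigma]
    refine Finset.sum_congr rfl fun u _ => Finset.sum_congr rfl fun i _ => by ring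

lemma matT_qf_cI (k : ℕ) (d : ℕ → ℝ) (x : Fin k → ℝ) :
    x ⬝ᵥ matT k d *ᵥ x = ∑ u, ∑ v, cM ℝ (cI k u) (cI k v) * (x (cI k u) * x (cI k v)) -
      ∑ u, d (cI k u) * (x (cI k u)) ^ 2 := by
  rw [matT_qf]
  congr 1
  · rw [← (cI_bij k).sum_comp]
    refine Finset.sum_congr rfl fun u _ => ?_
    rw [← (cI_bij k).sum_comp]
  · rw [← (cI_bij k).sum_comp]

lemma NN_graph_iff (k : ℕ) (nn : Fin k → ℕ) (hnn : ∀ i, 1 ≤ nn i) (e : ℕ) :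
    NN (adjMat (bGraph k nn)) e ↔ NN (matT k fun i => ((chainN k nn i : ℝ))⁻¹) e := by
  set σ := Equiv.ofBijective _ (cI_bij k) with hσ
  have hσ' : ∀ v, σ.symm (cI k v) = v := fun v => σ.symm_apply_apply v
  constructor
  · rintro ⟨W, hd, hW⟩
    let P : ((Σ v : Fin ((k + 1) / 2) ⊕ Fin (k / 2), Fin (nn (toIdx v))) → ℝ) →ₗ[ℝ] (Fin k → ℝ) :=
      { toFun := fun x t => ∑ i, x ⟨σ.symm t, i⟩
        map_add' := by intro a b; funext t; simp [Finset.sum_add_distrib]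
        map_smul' := by intro a b; funext t; simp [Finset.mul_sum] }
    have hP : ∀ x v, P x (cI k v) = ∑ i, x ⟨v, i⟩ := by
      intro x v
      show ∑ i, x ⟨σ.symm (cI k v), i⟩ = _
      rw [hσ']
    have hinj : Function.Injective (P ∘ₗ W.subtype) := by
      rw [injective_iff_map_eq_zero]
      rintro ⟨x, hx⟩ h0
      have h0' : P x = 0 := h0
      have h1 := hW x hx
      rw [adjMat_qf] at h1
      have h2 : ∀ v, ∑ i, x ⟨v, i⟩ = 0 := by
        intro v; rw [← hP, h0']; rfl
      simp only [h2] at h1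
      have h3 : ∑ u, ∑ i, (x ⟨u, i⟩) ^ 2 = 0 := by
        apply le_antisymm
        · simp only [mul_zero, Finset.sum_const_zero] at h1
          linarith
        · exact Finset.sum_nonneg fun u _ => Finset.sum_nonneg fun i _ => sq_nonneg _
      have h4 : x = 0 := by
        funext ⟨u, i⟩
        have h5 := (Finset.sum_eq_zero_iff_of_nonneg (fun u _ =>
          Finset.sum_nonneg fun i _ => sq_nonneg (x ⟨u, i⟩))).1 h3 u (Finset.mem_univ _)
        have h6 := (Finset.sum_eq_zero_iff_of_nonneg (fun i _ => sq_nonneg (x ⟨u, i⟩))).1 h5 i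
          (Finset.mem_univ _)
        simpa using h6
      simpa using h4
    refine ⟨LinearMap.range (P ∘ₗ W.subtype), ?_, ?_⟩
    · rwa [LinearMap.finrank_range_of_inj hinj]
    · rintro _ ⟨⟨x, hx⟩, rfl⟩
      refine (hW x hx).trans ?_
      show _ ≤ P x ⬝ᵥ _ *ᵥ P x
      rw [adjMat_qf, matT_qf_cI]
      simp only [hP, chainN_cI]
      apply sub_le_sub_left
      refine Finset.sum_le_sum fun u _ => ?_
      have hpos : (0 : ℝ) < nn (toIdx u) := by exact_mod_cast hnn _
      have := sq_sum_le_card_mul_sum_sq (s := Finset.univ) (f := fun i => x ⟨u, i⟩)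
      simp only [Finset.card_univ, Fintype.card_fin] at this
      rw [inv_mul_le_iff₀ hpos]
      exact this
  · rintro ⟨W, hd, hW⟩
    let Q : (Fin k → ℝ) →ₗ[ℝ] ((Σ v : Fin ((k + 1) / 2) ⊕ Fin (k / 2), Fin (nn (toIdx v))) → ℝ) :=
      { toFun := fun y p => ((nn (toIdx p.1) : ℝ))⁻¹ * y (cI k p.1)
        map_add' := by intro a b; funext t; simp [mul_add]
        map_smul' := by intro a b; funext t; simp; ring }
    have hpos : ∀ u, (0 : ℝ) < nn (toIdx (k := k) u) := fun u => by exact_mod_cast hnn _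
    have hinj : Function.Injective (Q ∘ₗ W.subtype) := by
      rw [injective_iff_map_eq_zero]
      rintro ⟨y, hy⟩ h0
      have h0' : Q y = 0 := h0
      have : y = 0 := by
        funext t
        obtain ⟨v, rfl⟩ := (cI_bij k).2 t
        have h1 := congrFun h0' ⟨v, ⟨0, hnn _⟩⟩
        have h2 : ((nn (toIdx v) : ℝ))⁻¹ * y (cI k v) = 0 := h1
        rcases mul_eq_zero.1 h2 with h | h
        · exact absurd h (inv_ne_zero (hpos v).ne')
        · exact h
      simpa using this
    refine ⟨LinearMap.range (Q ∘ₗ W.subtype), ?_, ?_⟩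
    · rwa [LinearMap.finrank_range_of_inj hinj]
    · rintro _ ⟨⟨y, hy⟩, rfl⟩
      refine (hW y hy).trans (le_of_eq ?_)
      show _ = Q y ⬝ᵥ _ *ᵥ Q y
      have hQ : ∀ u i, Q y ⟨u, i⟩ = ((nn (toIdx u) : ℝ))⁻¹ * y (cI k u) := fun u i => rfl
      rw [adjMat_qf, matT_qf_cI]
      simp only [hQ, chainN_cI, Finset.sum_const, Finset.card_univ, Fintype.card_fin, nsmul_eq_mul]
      congr 1
      · refine Finset.sum_congr rfl fun u _ => Finset.sum_congr rfl fun v _ => ?_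
        rw [mul_inv_cancel_left₀ (hpos u).ne', mul_inv_cancel_left₀ (hpos v).ne']
      · refine Finset.sum_congr rfl fun u _ => ?_
        have := (hpos u).ne'
        field_simp

lemma chainN_sum (k : ℕ) (nn : Fin k → ℕ) : ∑ i ∈ Finset.range k, chainN k nn i = ∑ i, nn i := by
  rw [← Fin.sum_univ_eq_sum_range, ← (cI_bij k).sum_comp, ← (toIdx_bij k).sum_comp]
  exact Finset.sum_congr rfl fun v _ => chainN_cI k nn v

lemma extend_sum (k : ℕ) (N : ℕ → ℕ) (S d : ℕ) : ∀ m : ℕ → ℕ, (∀ i, i < k → m i ≤ N i) →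
    ∑ i ∈ Finset.range k, m i + d = S → S ≤ ∑ i ∈ Finset.range k, N i →
    ∃ m' : ℕ → ℕ, (∀ i, i < k → m i ≤ m' i ∧ m' i ≤ N i) ∧ ∑ i ∈ Finset.range k, m' i = S := by
  induction d with
  | zero => intro m hm hs _; exact ⟨m, fun i hi => ⟨le_rfl, hm i hi⟩, hs⟩
  | succ d ih =>
    intro m hm hs hN
    obtain ⟨i, hi, hlt⟩ : ∃ i ∈ Finset.range k, m i < N i :=
      Finset.exists_lt_of_sum_lt (by omega)
    have hik : i < k := by simpa using hi
    obtain ⟨m', h1, h2⟩ := ih (Function.update m i (m i + 1)) (by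
      intro j hj
      by_cases h : j = i
      · subst h; simpa using hlt
      · simpa [h] using hm j hj) (by
      rw [Finset.sum_update_of_mem hi]
      rw [← Finset.sum_sdiff (Finset.singleton_subset_iff.2 hi)] at hs
      simp at hs ⊢; omega) hN
    refine ⟨m', fun j hj => ⟨?_, (h1 j hj).2⟩, h2⟩
    have := (h1 j hj).1
    by_cases h : j = i
    · subst h; simp at this; omega
    · simpa [h] using this

lemma bGraph_embed (k : ℕ) (mm nn : Fin k → ℕ) (h : ∀ i, mm i ≤ nn i) :
    Nonempty (bGraph k mm ↪g bGraph k nn) := by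
  let f : (Σ v : Fin ((k + 1) / 2) ⊕ Fin (k / 2), Fin (mm (toIdx v))) →
      (Σ v : Fin ((k + 1) / 2) ⊕ Fin (k / 2), Fin (nn (toIdx v))) :=
    Sigma.map id fun v => Fin.castLE (h (toIdx v))
  have hf : Function.Injective f :=
    Function.Injective.sigma_map Function.injective_id fun v => Fin.castLE_injective _
  refine ⟨⟨⟨f, hf⟩, ?_⟩⟩
  intro a b
  show (bGraph k nn).Adj (f a) (f b) ↔ _
  unfold bGraph lexProd
  rw [SimpleGraph.fromRel_adj, SimpleGraph.fromRel_adj, hf.ne_iff]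
  rfl

lemma bGraph_lam_iff (k : ℕ) (h4 : 4 ≤ k) (nn : Fin k → ℕ) (hnn : ∀ i, 1 ≤ nn i) :
    0 ≤ lam (bGraph k nn) 3 ↔ NN (matT k fun i => ((chainN k nn i : ℝ))⁻¹) 3 := by
  rw [← NN_graph_iff k nn hnn, lam_three_iff]
  rw [Fintype.card_sigma]
  simp only [Fintype.card_fin]
  have := (toIdx_bij k).sum_comp nn
  rw [this]
  have h : ∑ i : Fin k, 1 ≤ ∑ i : Fin k, nn i := Finset.sum_le_sum fun i _ => hnn i
  simp at h
  omega


theorem induced_subgraph_order15 (k : ℕ) (hk4 : 4 ≤ k) (hk9 : k ≤ 9)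
    (nn : Fin k → ℕ) (hnn : ∀ i, 1 ≤ nn i) (hsum : 15 ≤ ∑ i, nn i)
    (hlam : 0 ≤ lam (bGraph k nn) 3) :
    ∃ mm : Fin k → ℕ, (∀ i, 1 ≤ mm i) ∧ (∑ i, mm i) = 15 ∧
      Nonempty (bGraph k mm ↪g bGraph k nn) ∧ 0 ≤ lam (bGraph k mm) 3 := by
  set N := chainN k nn with hNdef
  have hN1 : ∀ i, i < k → 1 ≤ N i := by
    intro i hi
    obtain ⟨v, hv⟩ := (cI_bij k).2 ⟨i, hi⟩
    have h1 := chainN_cI k nn v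
    rw [hv] at h1
    have h2 : N i = nn (toIdx v) := h1
    rw [h2]
    exact hnn _
  have hNsum : 15 ≤ ∑ i ∈ Finset.range k, N i := by
    rw [hNdef, chainN_sum]; exact hsum
  rw [bGraph_lam_iff k hk4 nn hnn] at hlam
  obtain ⟨m, hm, hms, hmF⟩ : ∃ m : ℕ → ℕ, (∀ i, i < k → 1 ≤ m i ∧ m i ≤ N i) ∧
      ∑ i ∈ Finset.range k, m i ≤ 15 ∧ detF k (fun i => (m i : ℤ)) ≤ 0 := by
    by_contra hcon
    push Not at hcon
    refine not_NN_of_pos k hk4 hk9 _ N rfl hN1 ?_ hlam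
    intro m hm
    refine detF_pos_of_small k hk4 hk9 m (fun i hi => (hm i hi).1) ?_
    intro m' hm' hs'
    exact hcon m' (fun i hi => ⟨(hm' i hi).1, (hm' i hi).2.trans (hm i hi).2⟩) hs'
  obtain ⟨m', hm', hm's⟩ := extend_sum k N 15 (15 - ∑ i ∈ Finset.range k, m i) m
    (fun i hi => (hm i hi).2) (by omega) hNsum
  let τ := Equiv.ofBijective _ (toIdx_bij k)
  let mm : Fin k → ℕ := fun i => m' (cI k (τ.symm i))
  have hmm : ∀ v, mm (toIdx v) = m' (cI k v) := by
    intro v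
    show m' (cI k (τ.symm (τ v))) = _
    rw [Equiv.symm_apply_apply]
  have hch : ∀ i, i < k → chainN k mm i = m' i := by
    intro i hi
    obtain ⟨v, hv⟩ := (cI_bij k).2 ⟨i, hi⟩
    have h1 := chainN_cI k mm v
    rw [hmm, hv] at h1
    exact h1
  have hmm1 : ∀ i, 1 ≤ mm i := fun i => ((hm _ (Fin.isLt _)).1).trans (hm' _ (Fin.isLt _)).1
  refine ⟨mm, hmm1, ?_, bGraph_embed k mm nn ?_, ?_⟩
  · rw [← chainN_sum, ← hm's]
    exact Finset.sum_congr rfl fun i hi => hch i (by simpa using hi)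
  · intro i
    obtain ⟨v, rfl⟩ := (toIdx_bij k).2 i
    rw [hmm, ← chainN_cI k nn v]
    exact (hm' _ (Fin.isLt _)).2
  · rw [bGraph_lam_iff k hk4 mm hmm1,
      matT_congr k _ (fun i => ((m' i : ℝ))⁻¹) (fun i hi => by rw [hch i hi])]
    refine NN_mono k m m' (fun i hi => ⟨(hm i hi).1, (hm' i hi).1⟩) 3 ?_
    exact NN_of_nonpos k hk4 m (fun i hi => (hm i hi).1) hmF

end TwoPosEig
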